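/- Each circle C_k is a limit cycle of the vector field X_T, and it is a stable limit cycle if N_k is odd and an unstable limit cycle if N_k is even, where N_k := #{ j ≠ k : C_k ⊆ D_{C_j} } is the number of circles of the configuration whose bounded disc contains C_k. -/

import Mathlib

open MvPolynomial Function Set Filter Real
open scoped Classical

noncomputable section

/-- Bivariate real polynomials, representing components of planar polynomial vector fields. -/
abbrev Poly2 := MvPolynomial (Fin 2) ℝ

/-- Evaluation of a bivariate polynomial at a point of the plane. -/
def pev (P : Poly2) (p : ℝ × ℝ) : ℝ := MvPolynomial.eval ![p.1, p.2] P

/-- The circle polynomial `f(x,y) = (x−a)² + (y−b)² − ρ²`. -/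
def fpoly (c : ℝ × ℝ) (ρ : ℝ) : Poly2 :=
  (X 0 - MvPolynomial.C c.1) ^ 2 + (X 1 - MvPolynomial.C c.2) ^ 2 - MvPolynomial.C (ρ ^ 2)

/-- The divergence `∂P/∂x + ∂Q/∂y` of the vector field `X = P ∂ₓ + Q ∂ᵧ`. -/
def divPoly (P Q : Poly2) : Poly2 := pderiv 0 P + pderiv 1 Q

/-- `γ : ℝ → ℝ²` is a (C¹) solution of the vector field `X = P ∂ₓ + Q ∂ᵧ`. -/
def IsSolution (P Q : Poly2) (γ : ℝ → ℝ × ℝ) : Prop :=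
  ∀ t, HasDerivAt γ (pev P (γ t), pev Q (γ t)) t

/-- `S` is a periodic orbit of `X = P ∂ₓ + Q ∂ᵧ`: the image of a nonconstant periodic solution. -/
def IsPeriodicOrbit (P Q : Poly2) (S : Set (ℝ × ℝ)) : Prop :=
  ∃ γ : ℝ → ℝ × ℝ, ∃ T : ℝ, 0 < T ∧ IsSolution P Q γ ∧ Function.Periodic γ T ∧
    (∃ t₀ t₁, γ t₀ ≠ γ t₁) ∧ Set.range γ = S

/-- `S` is a limit cycle: a periodic orbit with a neighborhood meeting no other periodic orbit. -/
def IsLimitCycle (P Q : Poly2) (S : Set (ℝ × ℝ)) : Prop :=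
  IsPeriodicOrbit P Q S ∧
  ∃ U : Set (ℝ × ℝ), IsOpen U ∧ S ⊆ U ∧
    ∀ S', IsPeriodicOrbit P Q S' → S' ≠ S → Disjoint S' U

/-- `T` is the least positive period of `γ`. -/
def IsLeastPeriod (γ : ℝ → ℝ × ℝ) (T : ℝ) : Prop :=
  0 < T ∧ Function.Periodic γ T ∧ ∀ T', 0 < T' → Function.Periodic γ T' → T ≤ T'

/-- The (limit) cycle `S` has least period `T`: it is parametrized by a solution of least
period `T`. -/
def HasLeastPeriodCycle (P Q : Poly2) (S : Set (ℝ × ℝ)) (T : ℝ) : Prop :=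
  ∃ γ : ℝ → ℝ × ℝ, IsSolution P Q γ ∧ Set.range γ = S ∧ IsLeastPeriod γ T

/-- `V` is a (polynomial) inverse integrating factor of `X = P ∂ₓ + Q ∂ᵧ`:
`P ∂V/∂x + Q ∂V/∂y = V (∂P/∂x + ∂Q/∂y)`. -/
def IsInvFactor (P Q V : Poly2) : Prop :=
  P * pderiv 0 V + Q * pderiv 1 V = V * divPoly P Q

/-- An embedded closed curve in the plane: a set homeomorphic to the circle. -/
def IsCycle (S : Set (ℝ × ℝ)) : Prop :=
  Nonempty (S ≃ₜ Metric.sphere (0 : ℝ × ℝ) 1)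

/-- The compact region `D_C` bounded by a closed curve `C`: the curve together with the
points of the complement whose connected component in the complement is bounded. -/
def encDisk (S : Set (ℝ × ℝ)) : Set (ℝ × ℝ) :=
  S ∪ {p | p ∉ S ∧ Bornology.IsBounded (connectedComponentIn Sᶜ p)}

/-- `C_k` is a primary cycle of the configuration `Γ`: no other `C_j` is contained in `D_{C_k}`. -/
def PrimaryCycle {n : ℕ} (Γ : Fin n → Set (ℝ × ℝ)) (k : Fin n) : Prop :=
  ∀ j, j ≠ k → ¬ Γ j ⊆ encDisk (Γ k)

/-- The limit cycle `S`, with enclosed region `D`, is stable in the interior for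
`X = P ∂ₓ + Q ∂ᵧ`: every solution starting in the bounded region enclosed by `S`
sufficiently close to `S` converges to `S` as `t → +∞`. -/
def InteriorStable (P Q : Poly2) (S D : Set (ℝ × ℝ)) : Prop :=
  ∃ U : Set (ℝ × ℝ), IsOpen U ∧ S ⊆ U ∧
    ∀ γ : ℝ → ℝ × ℝ, IsSolution P Q γ → γ 0 ∈ (D \ S) ∩ U →
      Filter.Tendsto (fun t => Metric.infDist (γ t) S) Filter.atTop (nhds 0)

/-- The limit cycle `S`, with enclosed region `D`, is unstable in the interior:
every solution starting in the bounded region enclosed by `S` sufficiently close to `S`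
converges to `S` as `t → −∞`. -/
def InteriorUnstable (P Q : Poly2) (S D : Set (ℝ × ℝ)) : Prop :=
  ∃ U : Set (ℝ × ℝ), IsOpen U ∧ S ⊆ U ∧
    ∀ γ : ℝ → ℝ × ℝ, IsSolution P Q γ → γ 0 ∈ (D \ S) ∩ U →
      Filter.Tendsto (fun t => Metric.infDist (γ t) S) Filter.atBot (nhds 0)

/-- The polynomial `g(x,y) = (x−a)² + (y−b)²`. -/
def gpoly (c : ℝ × ℝ) : Poly2 :=
  (X 0 - MvPolynomial.C c.1) ^ 2 + (X 1 - MvPolynomial.C c.2) ^ 2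

variable {n : ℕ}

/-- `f_k(x,y) = (x−x_k)² + (y−y_k)² − r_k²`. -/
def fk (ctr : Fin n → ℝ × ℝ) (rad : Fin n → ℝ) (k : Fin n) : Poly2 :=
  fpoly (ctr k) (rad k)

/-- The circle `C_k = f_k⁻¹(0)`. -/
def Ccir (ctr : Fin n → ℝ × ℝ) (rad : Fin n → ℝ) (k : Fin n) : Set (ℝ × ℝ) :=
  {p : ℝ × ℝ | pev (fk ctr rad k) p = 0}

/-- The closed disc `D_{C_k}` bounded by the circle `C_k`. -/
def Ddisc (ctr : Fin n → ℝ × ℝ) (rad : Fin n → ℝ) (k : Fin n) : Set (ℝ × ℝ) :=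
  {p : ℝ × ℝ | (p.1 - (ctr k).1) ^ 2 + (p.2 - (ctr k).2) ^ 2 ≤ (rad k) ^ 2}

/-- `C_k` is primary: no other circle `C_j` is contained in `D_{C_k}`. -/
def Primary (ctr : Fin n → ℝ × ℝ) (rad : Fin n → ℝ) (k : Fin n) : Prop :=
  ∀ j, j ≠ k → ¬ Ccir ctr rad j ⊆ Ddisc ctr rad k

/-- `A = ∏_{k=1}^n f_k`. -/
def Apoly (ctr : Fin n → ℝ × ℝ) (rad : Fin n → ℝ) : Poly2 := ∏ k, fk ctr rad k

/-- `B = ∏_{k=1}^r g_k` (product over the primary indices, i.e. those with `k < r`). -/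
def Bpoly (r : ℕ) (ctr : Fin n → ℝ × ℝ) : Poly2 :=
  ∏ k ∈ Finset.univ.filter (fun k : Fin n => (k : ℕ) < r), gpoly (ctr k)

/-- `μ_k = ∏_{j≠k} f_j`. -/
def muk (ctr : Fin n → ℝ × ℝ) (rad : Fin n → ℝ) (k : Fin n) : Poly2 :=
  ∏ j ∈ Finset.univ.erase k, fk ctr rad j

/-- `P_T = A(∂B/∂x − ∂B/∂y) − B Σ_k τ_k μ_k ∂f_k/∂y`. -/
def PT (r : ℕ) (ctr : Fin n → ℝ × ℝ) (rad τ : Fin n → ℝ) : Poly2 :=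
  Apoly ctr rad * (pderiv 0 (Bpoly r ctr) - pderiv 1 (Bpoly r ctr)) -
    Bpoly r ctr * ∑ k, MvPolynomial.C (τ k) * muk ctr rad k * pderiv 1 (fk ctr rad k)

/-- `Q_T = A(∂B/∂x + ∂B/∂y) + B Σ_k τ_k μ_k ∂f_k/∂x`. -/
def QT (r : ℕ) (ctr : Fin n → ℝ × ℝ) (rad τ : Fin n → ℝ) : Poly2 :=
  Apoly ctr rad * (pderiv 0 (Bpoly r ctr) + pderiv 1 (Bpoly r ctr)) +
    Bpoly r ctr * ∑ k, MvPolynomial.C (τ k) * muk ctr rad k * pderiv 0 (fk ctr rad k)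

/-- `N_k`: the number of circles `C_j`, `j ≠ k`, whose bounded disc contains `C_k`. -/
def Nk (ctr : Fin n → ℝ × ℝ) (rad : Fin n → ℝ) (k : Fin n) : ℕ :=
  Nat.card {j : Fin n // j ≠ k ∧ Ccir ctr rad k ⊆ Ddisc ctr rad j}

/-- `s_k`: the number of primary circles contained in the closed disc `D_{C_k}`. -/
def sk (r : ℕ) (ctr : Fin n → ℝ × ℝ) (rad : Fin n → ℝ) (k : Fin n) : ℕ :=
  Nat.card {j : Fin n // (j : ℕ) < r ∧ Ccir ctr rad j ⊆ Ddisc ctr rad k}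

@[simp] lemma pev_add (P Q : Poly2) (p : ℝ × ℝ) : pev (P + Q) p = pev P p + pev Q p := by
  simp [pev]

@[simp] lemma pev_sub (P Q : Poly2) (p : ℝ × ℝ) : pev (P - Q) p = pev P p - pev Q p := by
  simp [pev]

@[simp] lemma pev_mul (P Q : Poly2) (p : ℝ × ℝ) : pev (P * Q) p = pev P p * pev Q p := by
  simp [pev]

@[simp] lemma pev_C (a : ℝ) (p : ℝ × ℝ) : pev (MvPolynomial.C a) p = a := by
  simp [pev]

@[simp] lemma pev_X_zero (p : ℝ × ℝ) : pev (X 0) p = p.1 := by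
  simp [pev]

@[simp] lemma pev_X_one (p : ℝ × ℝ) : pev (X 1) p = p.2 := by
  simp [pev]

@[simp] lemma pev_one (p : ℝ × ℝ) : pev 1 p = 1 := by
  simp [pev]

@[simp] lemma pev_zero (p : ℝ × ℝ) : pev 0 p = 0 := by
  simp [pev]

lemma pev_sum {ι : Type*} (s : Finset ι) (P : ι → Poly2) (p : ℝ × ℝ) :
    pev (∑ i ∈ s, P i) p = ∑ i ∈ s, pev (P i) p := by
  simp [pev]

lemma pev_prod {ι : Type*} (s : Finset ι) (P : ι → Poly2) (p : ℝ × ℝ) :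
    pev (∏ i ∈ s, P i) p = ∏ i ∈ s, pev (P i) p := by
  simp [pev, map_prod]

lemma pev_gpoly (c p : ℝ × ℝ) : pev (gpoly c) p = (p.1 - c.1) ^ 2 + (p.2 - c.2) ^ 2 := by
  simp [pev, gpoly]

lemma pev_fpoly (c : ℝ × ℝ) (ρ : ℝ) (p : ℝ × ℝ) :
    pev (fpoly c ρ) p = (p.1 - c.1) ^ 2 + (p.2 - c.2) ^ 2 - ρ ^ 2 := by
  simp [pev, fpoly]

lemma pderiv_zero_gpoly (c : ℝ × ℝ) :
    pderiv 0 (gpoly c) = MvPolynomial.C 2 * (X 0 - MvPolynomial.C c.1) := by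
  have h : (MvPolynomial.C 2 : Poly2) = 2 := map_ofNat MvPolynomial.C 2
  simp [gpoly, h, pderiv_X]

lemma pderiv_one_gpoly (c : ℝ × ℝ) :
    pderiv 1 (gpoly c) = MvPolynomial.C 2 * (X 1 - MvPolynomial.C c.2) := by
  have h : (MvPolynomial.C 2 : Poly2) = 2 := map_ofNat MvPolynomial.C 2
  simp [gpoly, h, pderiv_X]

lemma fpoly_eq_gpoly_sub (c : ℝ × ℝ) (ρ : ℝ) :
    fpoly c ρ = gpoly c - MvPolynomial.C (ρ ^ 2) := rfl

lemma pderiv_fpoly (i : Fin 2) (c : ℝ × ℝ) (ρ : ℝ) :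
    pderiv i (fpoly c ρ) = pderiv i (gpoly c) := by
  rw [fpoly_eq_gpoly_sub, map_sub, pderiv_C, sub_zero]

lemma pev_pderiv_zero_gpoly (c p : ℝ × ℝ) : pev (pderiv 0 (gpoly c)) p = 2 * (p.1 - c.1) := by
  rw [pderiv_zero_gpoly]; simp [pev]

lemma pev_pderiv_one_gpoly (c p : ℝ × ℝ) : pev (pderiv 1 (gpoly c)) p = 2 * (p.2 - c.2) := by
  rw [pderiv_one_gpoly]; simp [pev]

/-- Logarithmic derivative of a product of polynomials. -/
lemma pev_pderiv_prod {ι : Type*} (i : Fin 2) (s : Finset ι) (P : ι → Poly2) (p : ℝ × ℝ)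
    (h : ∀ j ∈ s, pev (P j) p ≠ 0) :
    pev (pderiv i (∏ j ∈ s, P j)) p =
      pev (∏ j ∈ s, P j) p * ∑ j ∈ s, pev (pderiv i (P j)) p / pev (P j) p := by
  induction s using Finset.cons_induction with
  | empty => simp
  | cons a s ha ih =>
    have h1 := ih fun j hj => h j (Finset.mem_cons_of_mem hj)
    have h2 := h a (Finset.mem_cons_self a s)
    rw [Finset.prod_cons, Finset.sum_cons, Derivation.leibniz]
    simp only [smul_eq_mul, pev_add, pev_mul, h1]
    field_simp
    ring

lemma contDiff_pev (P : Poly2) : ContDiff ℝ 1 (pev P) := by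
  induction P using MvPolynomial.induction_on with
  | C a => simpa [funext (pev_C a)] using contDiff_const
  | add P Q hP hQ => simpa only [funext (pev_add P Q)] using hP.add hQ
  | mul_X P i hP =>
    have hX : ContDiff ℝ 1 (pev (X i)) := by
      fin_cases i
      · exact (funext pev_X_zero : pev (X 0) = Prod.fst) ▸ contDiff_fst
      · exact (funext pev_X_one : pev (X 1) = Prod.snd) ▸ contDiff_snd
    simpa only [funext (pev_mul P (X i))] using hP.mul hX

lemma continuous_pev (P : Poly2) : Continuous (pev P) := (contDiff_pev P).continuous

lemma HasDerivAt.fst {γ : ℝ → ℝ × ℝ} {u v t : ℝ} (hγ : HasDerivAt γ (u, v) t) :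
    HasDerivAt (fun s => (γ s).1) u t :=
  (hasFDerivAt_fst (𝕜 := ℝ) (p := γ t)).comp_hasDerivAt t hγ

lemma HasDerivAt.snd {γ : ℝ → ℝ × ℝ} {u v t : ℝ} (hγ : HasDerivAt γ (u, v) t) :
    HasDerivAt (fun s => (γ s).2) v t :=
  (hasFDerivAt_snd (𝕜 := ℝ) (p := γ t)).comp_hasDerivAt t hγ

lemma HasDerivAt.pev_comp (P : Poly2) {γ : ℝ → ℝ × ℝ} {u v t : ℝ}
    (hγ : HasDerivAt γ (u, v) t) :
    HasDerivAt (fun s => pev P (γ s))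
      (pev (pderiv 0 P) (γ t) * u + pev (pderiv 1 P) (γ t) * v) t := by
  induction P using MvPolynomial.induction_on with
  | C a => simpa using hasDerivAt_const t a
  | add P Q hP hQ =>
    simp only [pev_add, map_add]
    exact (hP.add hQ).congr_deriv (by ring)
  | mul_X P i hP =>
    have hX : HasDerivAt (fun s => pev (X i) (γ s))
        (pev (pderiv 0 (X i)) (γ t) * u + pev (pderiv 1 (X i)) (γ t) * v) t := by
      fin_cases i
      · simpa [pderiv_X] using hγ.fst
      · simpa [pderiv_X] using hγ.snd
    simp only [pev_mul, Derivation.leibniz, smul_eq_mul, pev_add]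
    exact (hP.mul hX).congr_deriv (by ring)

/-- The velocity field of `P ∂ₓ + Q ∂ᵧ` determines a bounded solution from one value. -/
lemma IsSolution.eq_of_eq {P Q : Poly2} {γ δ : ℝ → ℝ × ℝ} (hγ : IsSolution P Q γ)
    (hδ : IsSolution P Q δ) (bγ : Bornology.IsBounded (range γ))
    (bδ : Bornology.IsBounded (range δ)) {t : ℝ} (h : γ t = δ t) : γ = δ := by
  obtain ⟨R, hR⟩ := (bγ.union bδ).subset_closedBall 0
  have hX : ContDiff ℝ 1 fun p => (pev P p, pev Q p) := (contDiff_pev P).prodMk (contDiff_pev Q)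
  obtain ⟨K, hK⟩ := (hX.locallyLipschitz.locallyLipschitzOn
    (s := Metric.closedBall 0 R)).exists_lipschitzOnWith_of_compact (isCompact_closedBall 0 R)
  exact ODE_solution_unique_univ (v := fun _ p => (pev P p, pev Q p)) (fun _ => hK)
    (fun s => ⟨hγ s, hR (.inl (mem_range_self s))⟩)
    (fun s => ⟨hδ s, hR (.inr (mem_range_self s))⟩) h

lemma IsSolution.continuous {P Q : Poly2} {γ : ℝ → ℝ × ℝ} (hγ : IsSolution P Q γ) :
    Continuous γ :=
  continuous_iff_continuousAt.2 fun t => (hγ t).continuousAt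

lemma IsSolution.comp_add_const {P Q : Poly2} {γ : ℝ → ℝ × ℝ} (hγ : IsSolution P Q γ) (a : ℝ) :
    IsSolution P Q fun t => γ (t + a) := fun t => (hγ (t + a)).comp_add_const t a

/-- Two periodic solutions with a common point have the same image. -/
lemma IsSolution.range_eq {P Q : Poly2} {γ δ : ℝ → ℝ × ℝ} (hγ : IsSolution P Q γ)
    (hδ : IsSolution P Q δ) {T S : ℝ} (hT : 0 < T) (hS : 0 < S) (pγ : Periodic γ T)
    (pδ : Periodic δ S) {a b : ℝ} (h : γ a = δ b) : range γ = range δ := by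
  have key := (hγ.comp_add_const a).eq_of_eq (hδ.comp_add_const b) (t := 0)
    ((pγ.compact_of_continuous hT.ne' hγ.continuous).isBounded.subset
      (range_comp_subset_range (· + a) γ))
    ((pδ.compact_of_continuous hS.ne' hδ.continuous).isBounded.subset
      (range_comp_subset_range (· + b) δ)) (by simpa using h)
  have := congrArg range key
  rwa [← Function.comp_def γ, ← Function.comp_def δ, (add_right_surjective a).range_comp,
    (add_right_surjective b).range_comp] at this

/-- A positive periodic scalar field has a flow line running through all of `ℝ`. -/
lemma exists_hasDerivAt_of_periodic_pos {v : ℝ → ℝ} {L : ℝ} (hL : 0 < L) (hv : Continuous v)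
    (hpos : ∀ x, 0 < v x) (hper : Periodic v L) :
    ∃ θ : ℝ → ℝ, ∃ T, 0 < T ∧ (∀ t, HasDerivAt θ (v (θ t)) t) ∧ (∀ t, θ (t + T) = θ t + L) ∧
      Surjective θ := by
  have hw : Continuous fun x => (v x)⁻¹ := hv.inv₀ fun x => (hpos x).ne'
  have hi : ∀ a b, IntervalIntegrable (fun x => (v x)⁻¹) MeasureTheory.volume a b :=
    fun a b => hw.intervalIntegrable a b
  have hp : Periodic (fun x => (v x)⁻¹) L := fun x => by simp only [hper x]
  have hwpos : ∀ x, 0 < (v x)⁻¹ := fun x => inv_pos.2 (hpos x)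
  let F : ℝ → ℝ := fun x => ∫ u in (0 : ℝ)..x, (v u)⁻¹
  have hF : ∀ x, HasDerivAt F (v x)⁻¹ x := fun x =>
    intervalIntegral.integral_hasDerivAt_right (hi 0 x) (hw.stronglyMeasurableAtFilter _ _)
      hw.continuousAt
  have hmono : StrictMono F := strictMono_of_hasDerivAt_pos hF hwpos
  have hsurj : Surjective F :=
    (continuous_iff_continuousAt.2 fun x => (hF x).continuousAt).surjective
    (hp.tendsto_atTop_intervalIntegral_of_pos' (hi 0 L) hwpos hL)
    (hp.tendsto_atBot_intervalIntegral_of_pos' (hi 0 L) hwpos hL)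
  let e := hmono.orderIsoOfSurjective F hsurj
  have he : ∀ t, F (e.symm t) = t := e.apply_symm_apply
  have hadd : ∀ x, F (x + L) = F x + F L := fun x => by
    simpa [F] using hp.intervalIntegral_add_eq_add 0 x hi
  refine ⟨e.symm, F L, ?_, fun t => ?_, fun t => ?_, e.symm.surjective⟩
  · simpa [F] using hmono hL
  · simpa using (hF (e.symm t)).of_local_left_inverse e.symm.continuous.continuousAt
      (hwpos _).ne' (.of_forall he)
  · rw [e.symm_apply_eq]
    exact ((hadd _).trans (congrArg (· + F L) (he t))).symm

/-- If `τ log u + w` strictly decreases wherever `u < ε`, with `w` bounded there, then `u` and `w`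
cannot both return to their values at `0` when `u 0` is small. -/
lemma not_return_of_log_decreasing {u w d : ℝ → ℝ} {T ε M τ : ℝ} (hT : 0 < T) (hε : 0 < ε)
    (hM : 0 ≤ M) (hτ : 0 < τ) (hu : Continuous u) (upos : ∀ t, 0 < u t)
    (hw : ∀ t, u t < ε → |w t| ≤ M)
    (hd : ∀ t, u t < ε → HasDerivAt (fun s => τ * Real.log (u s) + w s) (d t) t)
    (hneg : ∀ t, u t < ε → d t < 0)
    (h0 : u 0 < ε * Real.exp (-(2 * M / τ))) (pu : u T = u 0) (pw : w T = w 0) : False := by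
  have h0ε : u 0 < ε := h0.trans_le <| mul_le_of_le_one_right hε.le <|
    Real.exp_le_one_iff.2 (neg_nonpos.2 (by positivity))
  have anti : ∀ t, (∀ s ∈ Icc 0 t, u s < ε) →
      StrictAntiOn (fun s => τ * Real.log (u s) + w s) (Icc 0 t) := fun t ht =>
    strictAntiOn_of_deriv_neg (convex_Icc 0 t)
      (fun s hs => (hd s (ht s hs)).continuousAt.continuousWithinAt) fun s hs => by
        rw [interior_Icc] at hs
        rw [(hd s (ht s (Ioo_subset_Icc_self hs))).deriv]
        exact hneg s (ht s (Ioo_subset_Icc_self hs))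
  have trapped : ∀ t ∈ Icc 0 T, u t < ε := by
    by_contra! hcon
    obtain ⟨b, hb, hbε⟩ := hcon
    have hcpt : IsCompact (Icc 0 T ∩ {t | ε ≤ u t}) :=
      isCompact_Icc.inter_right (isClosed_le continuous_const hu)
    obtain ⟨a, ⟨ha, haε⟩, hmin⟩ := hcpt.exists_isLeast ⟨b, hb, hbε⟩
    have hlt : ∀ s ∈ Ico 0 a, u s < ε := fun s hs => by
      by_contra! h
      exact hs.2.not_ge (hmin ⟨⟨hs.1, hs.2.le.trans ha.2⟩, h⟩)
    have ha0 : 0 ≠ a := by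
      rintro rfl
      exact h0ε.not_ge haε
    have hle : ∀ s ∈ Ico 0 a, u s ≤ u 0 * Real.exp (2 * M / τ) := fun s hs => by
      have h1 : τ * Real.log (u s) + w s ≤ τ * Real.log (u 0) + w 0 :=
        (anti s fun x hx => hlt x ⟨hx.1, hx.2.trans_lt hs.2⟩).antitoneOn
          (left_mem_Icc.2 hs.1) (right_mem_Icc.2 hs.1) hs.1
      have h2 := abs_le.1 (hw s (hlt s hs))
      have h3 := abs_le.1 (hw 0 h0ε)
      rw [← Real.log_le_log_iff (upos s) (mul_pos (upos 0) (Real.exp_pos _)),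
        Real.log_mul (upos 0).ne' (Real.exp_pos _).ne', Real.log_exp, ← sub_le_iff_le_add',
        le_div_iff₀ hτ]
      linarith
    have hlim : a ∈ closure (Ico 0 a) := by
      rw [closure_Ico ha0]
      exact right_mem_Icc.2 ha.1
    have h4 : u a ≤ u 0 * Real.exp (2 * M / τ) :=
      (isClosed_le hu continuous_const).closure_subset_iff.2 hle hlim
    have h5 := mul_lt_mul_of_pos_right h0 (Real.exp_pos (2 * M / τ))
    rw [mul_assoc, ← Real.exp_add, neg_add_cancel, Real.exp_zero, mul_one] at h5
    exact (h4.trans_lt h5).not_ge haε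
  have := anti T trapped (left_mem_Icc.2 hT.le) (right_mem_Icc.2 hT.le) hT
  simp only [pu, pw, lt_irrefl] at this

lemma pev_fk (ctr : Fin n → ℝ × ℝ) (rad : Fin n → ℝ) (k : Fin n) (z : ℝ × ℝ) :
    pev (fk ctr rad k) z = (z.1 - (ctr k).1) ^ 2 + (z.2 - (ctr k).2) ^ 2 - rad k ^ 2 :=
  pev_fpoly _ _ _

lemma pev_pderiv_zero_fk (ctr : Fin n → ℝ × ℝ) (rad : Fin n → ℝ) (k : Fin n) (z : ℝ × ℝ) :
    pev (pderiv 0 (fk ctr rad k)) z = 2 * (z.1 - (ctr k).1) := by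
  rw [fk, pderiv_fpoly, pev_pderiv_zero_gpoly]

lemma pev_pderiv_one_fk (ctr : Fin n → ℝ × ℝ) (rad : Fin n → ℝ) (k : Fin n) (z : ℝ × ℝ) :
    pev (pderiv 1 (fk ctr rad k)) z = 2 * (z.2 - (ctr k).2) := by
  rw [fk, pderiv_fpoly, pev_pderiv_one_gpoly]

/-- The indices of the centers that occur in `B`. -/
def primaryIdx (n r : ℕ) : Finset (Fin n) := Finset.univ.filter fun k : Fin n => (k : ℕ) < r

/-- The primary indices whose center lies inside `C_k`. -/
def innerIdx (r : ℕ) (ctr : Fin n → ℝ × ℝ) (rad : Fin n → ℝ) (k : Fin n) : Finset (Fin n) :=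
  (primaryIdx n r).filter fun i => pev (fk ctr rad k) (ctr i) < 0

/-- The primary indices whose center does not lie inside `C_k`. -/
def outerIdx (r : ℕ) (ctr : Fin n → ℝ × ℝ) (rad : Fin n → ℝ) (k : Fin n) : Finset (Fin n) :=
  (primaryIdx n r).filter fun i => ¬ pev (fk ctr rad k) (ctr i) < 0

/-- The factor `B μ_k`, the speed of `X_T` along `C_k` up to a constant. -/
def speed (r : ℕ) (ctr : Fin n → ℝ × ℝ) (rad : Fin n → ℝ) (k : Fin n) : Poly2 :=
  Bpoly r ctr * muk ctr rad k

/-- The quotient of the part of `P_T` that vanishes on `C_k` by `f_k`. -/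
def PTquot (r : ℕ) (ctr : Fin n → ℝ × ℝ) (rad τ : Fin n → ℝ) (k : Fin n) : Poly2 :=
  muk ctr rad k * (pderiv 0 (Bpoly r ctr) - pderiv 1 (Bpoly r ctr)) -
    Bpoly r ctr * ∑ j ∈ Finset.univ.erase k, MvPolynomial.C (τ j) *
      (∏ i ∈ (Finset.univ.erase k).erase j, fk ctr rad i) * pderiv 1 (fk ctr rad j)

/-- The quotient of the part of `Q_T` that vanishes on `C_k` by `f_k`. -/
def QTquot (r : ℕ) (ctr : Fin n → ℝ × ℝ) (rad τ : Fin n → ℝ) (k : Fin n) : Poly2 :=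
  muk ctr rad k * (pderiv 0 (Bpoly r ctr) + pderiv 1 (Bpoly r ctr)) +
    Bpoly r ctr * ∑ j ∈ Finset.univ.erase k, MvPolynomial.C (τ j) *
      (∏ i ∈ (Finset.univ.erase k).erase j, fk ctr rad i) * pderiv 0 (fk ctr rad j)

/-- The cofactor of the invariant circle `C_k`. -/
def cofactor (r : ℕ) (ctr : Fin n → ℝ × ℝ) (rad τ : Fin n → ℝ) (k : Fin n) : Poly2 :=
  pderiv 0 (fk ctr rad k) * PTquot r ctr rad τ k + pderiv 1 (fk ctr rad k) * QTquot r ctr rad τ k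

section

variable (r : ℕ) (ctr : Fin n → ℝ × ℝ) (rad τ : Fin n → ℝ) (k : Fin n)

lemma Apoly_eq : Apoly ctr rad = fk ctr rad k * muk ctr rad k :=
  (Finset.mul_prod_erase _ _ (Finset.mem_univ k)).symm

lemma muk_eq {j : Fin n} (hj : j ∈ Finset.univ.erase k) :
    muk ctr rad j = fk ctr rad k * ∏ i ∈ (Finset.univ.erase k).erase j, fk ctr rad i := by
  rw [muk, ← Finset.mul_prod_erase _ _
    (Finset.mem_erase.2 ⟨(Finset.ne_of_mem_erase hj).symm, Finset.mem_univ k⟩),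
    Finset.erase_right_comm]

lemma sum_muk_eq (i : Fin 2) :
    ∑ j, MvPolynomial.C (τ j) * muk ctr rad j * pderiv i (fk ctr rad j) =
      MvPolynomial.C (τ k) * muk ctr rad k * pderiv i (fk ctr rad k) +
      fk ctr rad k * ∑ j ∈ Finset.univ.erase k, MvPolynomial.C (τ j) *
        (∏ i ∈ (Finset.univ.erase k).erase j, fk ctr rad i) * pderiv i (fk ctr rad j) := by
  rw [← Finset.add_sum_erase _ _ (Finset.mem_univ k), Finset.mul_sum]
  congr 1
  refine Finset.sum_congr rfl fun j hj => ?_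
  rw [muk_eq ctr rad k hj]
  ring

lemma PT_eq : PT r ctr rad τ = fk ctr rad k * PTquot r ctr rad τ k -
    MvPolynomial.C (τ k) * (speed r ctr rad k * pderiv 1 (fk ctr rad k)) := by
  rw [PT, sum_muk_eq ctr rad τ k, Apoly_eq ctr rad k, PTquot, speed]
  ring

lemma QT_eq : QT r ctr rad τ = fk ctr rad k * QTquot r ctr rad τ k +
    MvPolynomial.C (τ k) * (speed r ctr rad k * pderiv 0 (fk ctr rad k)) := by
  rw [QT, sum_muk_eq ctr rad τ k, Apoly_eq ctr rad k, QTquot, speed]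
  ring

/-- `C_k` is invariant with cofactor `cofactor`. -/
lemma pderiv_fk_mul_PT (z : ℝ × ℝ) :
    pev (pderiv 0 (fk ctr rad k)) z * pev (PT r ctr rad τ) z +
      pev (pderiv 1 (fk ctr rad k)) z * pev (QT r ctr rad τ) z =
    pev (fk ctr rad k) z * pev (cofactor r ctr rad τ k) z := by
  rw [PT_eq r ctr rad τ k, QT_eq r ctr rad τ k, cofactor]
  simp only [pev_add, pev_sub, pev_mul]
  ring

/-- Along `C_k` the divergence is the cofactor plus the logarithmic derivative of `speed`. -/
lemma speed_mul_divPoly {z : ℝ × ℝ} (hz : pev (fk ctr rad k) z = 0) :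
    pev (speed r ctr rad k) z * pev (divPoly (PT r ctr rad τ) (QT r ctr rad τ)) z =
      pev (speed r ctr rad k) z * pev (cofactor r ctr rad τ k) z +
      (pev (pderiv 0 (speed r ctr rad k)) z * pev (PT r ctr rad τ) z +
        pev (pderiv 1 (speed r ctr rad k)) z * pev (QT r ctr rad τ) z) := by
  have h : pderiv 0 (pderiv 1 (fk ctr rad k)) = 0 ∧ pderiv 1 (pderiv 0 (fk ctr rad k)) = 0 := by
    simp only [fk, pderiv_fpoly, pderiv_zero_gpoly, pderiv_one_gpoly]
    simp [pderiv_X]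
  rw [PT_eq r ctr rad τ k, QT_eq r ctr rad τ k, cofactor, divPoly]
  simp only [map_add, map_sub, Derivation.leibniz, smul_eq_mul, pderiv_C, h.1, h.2, pev_add,
    pev_sub, pev_mul, pev_C, pev_zero, hz]
  ring

/-- The partial derivatives of `log B`. -/
def dlogB (i : Fin 2) (z : ℝ × ℝ) : ℝ :=
  ∑ j ∈ primaryIdx n r, pev (pderiv i (gpoly (ctr j))) z / pev (gpoly (ctr j)) z

/-- The partial derivatives of `∑_{j ≠ k} τ_j log |f_j|`. -/
def dlogF (i : Fin 2) (z : ℝ × ℝ) : ℝ :=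
  ∑ j ∈ Finset.univ.erase k, τ j * (pev (pderiv i (fk ctr rad j)) z / pev (fk ctr rad j) z)

variable {r ctr rad k}

lemma sum_prod_erase_eq {z : ℝ × ℝ} (hF : ∀ j ∈ Finset.univ.erase k, pev (fk ctr rad j) z ≠ 0)
    (i : Fin 2) :
    pev (∑ j ∈ Finset.univ.erase k, MvPolynomial.C (τ j) *
      (∏ i ∈ (Finset.univ.erase k).erase j, fk ctr rad i) * pderiv i (fk ctr rad j)) z =
    pev (muk ctr rad k) z * dlogF ctr rad τ k i z := by
  rw [pev_sum, dlogF, Finset.mul_sum]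
  refine Finset.sum_congr rfl fun j hj => ?_
  rw [muk, ← Finset.mul_prod_erase _ _ hj]
  simp only [pev_mul, pev_C]
  field_simp [hF j hj]

lemma pev_PTquot {z : ℝ × ℝ} (hG : ∀ i ∈ primaryIdx n r, pev (gpoly (ctr i)) z ≠ 0)
    (hF : ∀ j ∈ Finset.univ.erase k, pev (fk ctr rad j) z ≠ 0) :
    pev (PTquot r ctr rad τ k) z = pev (speed r ctr rad k) z *
      (dlogB r ctr 0 z - dlogB r ctr 1 z - dlogF ctr rad τ k 1 z) := by
  have hB := fun i => pev_pderiv_prod i (primaryIdx n r) (fun j => gpoly (ctr j)) z hG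
  rw [PTquot, pev_sub, pev_mul, pev_mul, sum_prod_erase_eq τ hF, pev_sub, Bpoly, ← primaryIdx,
    hB, hB, speed, pev_mul, Bpoly, ← primaryIdx, dlogB, dlogB]
  ring

lemma pev_QTquot {z : ℝ × ℝ} (hG : ∀ i ∈ primaryIdx n r, pev (gpoly (ctr i)) z ≠ 0)
    (hF : ∀ j ∈ Finset.univ.erase k, pev (fk ctr rad j) z ≠ 0) :
    pev (QTquot r ctr rad τ k) z = pev (speed r ctr rad k) z *
      (dlogB r ctr 0 z + dlogB r ctr 1 z + dlogF ctr rad τ k 0 z) := by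
  have hB := fun i => pev_pderiv_prod i (primaryIdx n r) (fun j => gpoly (ctr j)) z hG
  rw [QTquot, pev_add, pev_mul, pev_mul, sum_prod_erase_eq τ hF, pev_add, Bpoly, ← primaryIdx,
    hB, hB, speed, pev_mul, Bpoly, ← primaryIdx, dlogB, dlogB]
  ring

end

/-- The component of `z - p` along `a`. -/
def dotAt (p a z : ℝ × ℝ) : ℝ := a.1 * (z.1 - p.1) + a.2 * (z.2 - p.2)

/-- The component of `z - p` across `a`. -/
def crossAt (p a z : ℝ × ℝ) : ℝ := a.1 * (z.2 - p.2) - a.2 * (z.1 - p.1)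

lemma continuous_dotAt (p a : ℝ × ℝ) : Continuous (dotAt p a) := by
  unfold dotAt; fun_prop

lemma continuous_crossAt (p a : ℝ × ℝ) : Continuous (crossAt p a) := by
  unfold crossAt; fun_prop

/-- The rate of change of the angle about `p`. -/
def angularRate (P Q : Poly2) (p z : ℝ × ℝ) : ℝ :=
  ((z.1 - p.1) * pev Q z - (z.2 - p.2) * pev P z) / pev (gpoly p) z

lemma hasDerivAt_arctan_cross_div_dot {P Q : Poly2} {γ : ℝ → ℝ × ℝ} {t : ℝ} {p a : ℝ × ℝ}
    (hγ : HasDerivAt γ (pev P (γ t), pev Q (γ t)) t) (hdot : 0 < dotAt p a (γ t)) :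
    HasDerivAt (fun s => Real.arctan (crossAt p a (γ s) / dotAt p a (γ s)))
      (angularRate P Q p (γ t)) t := by
  have h1 := hγ.fst.sub_const p.1
  have h2 := hγ.snd.sub_const p.2
  have hd : HasDerivAt (fun s => dotAt p a (γ s)) _ t := (h1.const_mul a.1).add (h2.const_mul a.2)
  have hc : HasDerivAt (fun s => crossAt p a (γ s)) _ t :=
    (h2.const_mul a.1).sub (h1.const_mul a.2)
  refine (hc.div hd hdot.ne').arctan.congr_deriv ?_
  have hg : pev (gpoly p) (γ t) ≠ 0 := by
    rw [pev_gpoly]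
    intro h
    have e1 : (γ t).1 - p.1 = 0 := by nlinarith [sq_nonneg ((γ t).1 - p.1), sq_nonneg ((γ t).2 - p.2)]
    have e2 : (γ t).2 - p.2 = 0 := by nlinarith [sq_nonneg ((γ t).1 - p.1), sq_nonneg ((γ t).2 - p.2)]
    simp [dotAt, e1, e2] at hdot
  have hs : dotAt p a (γ t) ^ 2 + crossAt p a (γ t) ^ 2 ≠ 0 := by positivity
  have ha : dotAt p a (γ t) ^ 2 + crossAt p a (γ t) ^ 2 =
      (a.1 ^ 2 + a.2 ^ 2) * pev (gpoly p) (γ t) := by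
    rw [pev_gpoly, dotAt, crossAt]; ring
  have h3 := hdot.ne'
  rw [angularRate, one_div, Pi.div_apply, div_pow, one_add_div (pow_ne_zero 2 h3), inv_div,
    div_mul_div_cancel₀' (pow_ne_zero 2 h3), div_eq_div_iff hs hg, ha, dotAt, crossAt]
  ring

section

variable (r : ℕ) (ctr : Fin n → ℝ × ℝ) (rad τ : Fin n → ℝ) (k : Fin n)

/-- The part of the multivalued first integral of `X_T` that is single-valued and regular near
`C_k`. -/
def lyap (z : ℝ × ℝ) : ℝ :=
  ∑ i ∈ primaryIdx n r, Real.log (pev (gpoly (ctr i)) z) +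
    ∑ j ∈ Finset.univ.erase k, τ j * Real.log (pev (fk ctr rad j) z) -
    2 * ∑ i ∈ outerIdx r ctr rad k, Real.arctan
      (crossAt (ctr i) (ctr k - ctr i) z / dotAt (ctr i) (ctr k - ctr i) z)

/-- Twice the total angular rate of `X_T` about the primary centers inside `C_k`. -/
def swirl (z : ℝ × ℝ) : ℝ :=
  2 * ∑ i ∈ innerIdx r ctr rad k, angularRate (PT r ctr rad τ) (QT r ctr rad τ) (ctr i) z

/-- The region where `lyap` is smooth. -/
def regularRegion : Set (ℝ × ℝ) :=
  {z | (∀ i ∈ primaryIdx n r, pev (gpoly (ctr i)) z ≠ 0) ∧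
    (∀ j ∈ Finset.univ.erase k, pev (fk ctr rad j) z ≠ 0) ∧
    ∀ i ∈ outerIdx r ctr rad k, 0 < dotAt (ctr i) (ctr k - ctr i) z}

lemma isOpen_regularRegion : IsOpen (regularRegion r ctr rad k) := by
  simp only [regularRegion, ofPred_and, ofPred_forall]
  refine (isOpen_biInter_finset fun i _ => ?_).inter
    ((isOpen_biInter_finset fun j _ => ?_).inter (isOpen_biInter_finset fun i _ => ?_))
  · exact isOpen_ne_fun (continuous_pev _) continuous_const
  · exact isOpen_ne_fun (continuous_pev _) continuous_const
  · exact isOpen_lt continuous_const (continuous_dotAt _ _)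

lemma continuousOn_lyap : ContinuousOn (lyap r ctr rad τ k) (regularRegion r ctr rad k) := by
  refine ((continuousOn_finsetSum _ fun i hi => ?_).add
    (continuousOn_finsetSum _ fun j hj => ?_)).sub
    (continuousOn_const.mul (continuousOn_finsetSum _ fun i hi => ?_))
  · exact (continuous_pev _).continuousOn.log fun z hz => hz.1 i hi
  · exact continuousOn_const.mul ((continuous_pev _).continuousOn.log fun z hz => hz.2.1 j hj)
  · exact Real.continuous_arctan.comp_continuousOn ((continuous_crossAt _ _).continuousOn.div
      (continuous_dotAt _ _).continuousOn fun z hz => (hz.2.2 i hi).ne')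

lemma continuousOn_swirl : ContinuousOn (swirl r ctr rad τ k) (regularRegion r ctr rad k) := by
  refine continuousOn_const.mul (continuousOn_finsetSum _ fun i hi => ?_)
  refine ContinuousOn.div (Continuous.continuousOn ?_) (continuous_pev _).continuousOn
    fun z hz => hz.1 i (Finset.mem_filter.1 hi).1
  exact ((continuous_fst.sub continuous_const).mul (continuous_pev _)).sub
    ((continuous_snd.sub continuous_const).mul (continuous_pev _))

variable {r ctr rad τ k}

lemma hasDerivAt_log_pev (R : Poly2) {γ : ℝ → ℝ × ℝ} {u v t : ℝ}
    (hγ : HasDerivAt γ (u, v) t) (h : pev R (γ t) ≠ 0) :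
    HasDerivAt (fun s => Real.log (pev R (γ s)))
      (pev (pderiv 0 R) (γ t) / pev R (γ t) * u + pev (pderiv 1 R) (γ t) / pev R (γ t) * v) t :=
  ((hγ.pev_comp R).log h).congr_deriv (by ring)

lemma two_mul_sum_angularRate (P Q : Poly2) (z : ℝ × ℝ) :
    2 * ∑ i ∈ primaryIdx n r, angularRate P Q (ctr i) z =
      dlogB r ctr 0 z * pev Q z - dlogB r ctr 1 z * pev P z := by
  simp only [dlogB, Finset.mul_sum, Finset.sum_mul, ← Finset.sum_sub_distrib]
  refine Finset.sum_congr rfl fun i _ => ?_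
  rw [angularRate, pev_pderiv_zero_gpoly, pev_pderiv_one_gpoly]
  ring

/-- Along solutions near `C_k`, the derivative of `lyap` is the swirl minus `τ_k` times the
cofactor. -/
lemma hasDerivAt_lyap {γ : ℝ → ℝ × ℝ} {t : ℝ}
    (hγ : HasDerivAt γ (pev (PT r ctr rad τ) (γ t), pev (QT r ctr rad τ) (γ t)) t)
    (ht : γ t ∈ regularRegion r ctr rad k) :
    HasDerivAt (fun s => lyap r ctr rad τ k (γ s))
      (swirl r ctr rad τ k (γ t) - τ k * pev (cofactor r ctr rad τ k) (γ t)) t := by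
  obtain ⟨hG, hF, hdot⟩ := ht
  have h1 := HasDerivAt.fun_sum fun i hi => hasDerivAt_log_pev (gpoly (ctr i)) hγ (hG i hi)
  have h2 := HasDerivAt.fun_sum fun j hj =>
    (hasDerivAt_log_pev (fk ctr rad j) hγ (hF j hj)).const_mul (τ j)
  have h3 := (HasDerivAt.fun_sum fun i hi =>
    hasDerivAt_arctan_cross_div_dot hγ (hdot i hi)).const_mul 2
  refine ((h1.add h2).sub h3).congr_deriv ?_
  have e1 : ∀ u v : ℝ, ∑ i ∈ primaryIdx n r,
      (pev (pderiv 0 (gpoly (ctr i))) (γ t) / pev (gpoly (ctr i)) (γ t) * u +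
        pev (pderiv 1 (gpoly (ctr i))) (γ t) / pev (gpoly (ctr i)) (γ t) * v) =
      dlogB r ctr 0 (γ t) * u + dlogB r ctr 1 (γ t) * v := fun u v => by
    rw [Finset.sum_add_distrib, ← Finset.sum_mul, ← Finset.sum_mul, dlogB, dlogB]
  have e2 : ∀ u v : ℝ, ∑ j ∈ Finset.univ.erase k, τ j *
      (pev (pderiv 0 (fk ctr rad j)) (γ t) / pev (fk ctr rad j) (γ t) * u +
        pev (pderiv 1 (fk ctr rad j)) (γ t) / pev (fk ctr rad j) (γ t) * v) =
      dlogF ctr rad τ k 0 (γ t) * u + dlogF ctr rad τ k 1 (γ t) * v := fun u v => by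
    simp only [mul_add, ← mul_assoc]
    rw [Finset.sum_add_distrib, ← Finset.sum_mul, ← Finset.sum_mul, dlogF, dlogF]
  have e3 : 2 * ∑ i ∈ outerIdx r ctr rad k,
      angularRate (PT r ctr rad τ) (QT r ctr rad τ) (ctr i) (γ t) =
      dlogB r ctr 0 (γ t) * pev (QT r ctr rad τ) (γ t) -
        dlogB r ctr 1 (γ t) * pev (PT r ctr rad τ) (γ t) - swirl r ctr rad τ k (γ t) := by
    rw [← two_mul_sum_angularRate, swirl, eq_sub_iff_add_eq, ← mul_add, add_comm, innerIdx,
      outerIdx, Finset.sum_filter_add_sum_filter_not]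
  rw [e1, e2, e3, PT_eq r ctr rad τ k, QT_eq r ctr rad τ k, cofactor]
  simp only [pev_add, pev_sub, pev_mul, pev_C, pev_PTquot τ hG hF, pev_QTquot τ hG hF]
  ring

lemma hasDerivAt_log_fk_add_lyap {γ : ℝ → ℝ × ℝ} {t : ℝ}
    (hγ : HasDerivAt γ (pev (PT r ctr rad τ) (γ t), pev (QT r ctr rad τ) (γ t)) t)
    (ht : γ t ∈ regularRegion r ctr rad k) (hk : pev (fk ctr rad k) (γ t) ≠ 0) :
    HasDerivAt (fun s => τ k * Real.log |pev (fk ctr rad k) (γ s)| + lyap r ctr rad τ k (γ s))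
      (swirl r ctr rad τ k (γ t)) t := by
  simp only [Real.log_abs]
  refine (((hasDerivAt_log_pev (fk ctr rad k) hγ hk).const_mul (τ k)).add
    (hasDerivAt_lyap hγ ht)).congr_deriv ?_
  have := pderiv_fk_mul_PT r ctr rad τ k (γ t)
  field_simp
  linear_combination τ k * this

end

/-- The standard parametrization of the circle of center `c` and radius `ρ`. -/
def circlePt (c : ℝ × ℝ) (ρ θ : ℝ) : ℝ × ℝ := (c.1 + ρ * Real.cos θ, c.2 + ρ * Real.sin θ)

lemma continuous_circlePt (c : ℝ × ℝ) (ρ : ℝ) : Continuous (circlePt c ρ) := by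
  unfold circlePt; fun_prop

section

variable {r : ℕ} {ctr : Fin n → ℝ × ℝ} {rad τ : Fin n → ℝ} {k : Fin n}

lemma circlePt_mem (θ : ℝ) : circlePt (ctr k) (rad k) θ ∈ Ccir ctr rad k := by
  rw [Ccir, mem_ofPred_eq, pev_fk, circlePt]
  linear_combination rad k ^ 2 * Real.cos_sq_add_sin_sq θ

lemma range_circlePt (hk : 0 < rad k) : range (circlePt (ctr k) (rad k)) = Ccir ctr rad k := by
  refine Subset.antisymm (range_subset_iff.2 circlePt_mem) fun z hz => ?_
  rw [Ccir, mem_ofPred_eq, pev_fk] at hz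
  set w : ℂ := ⟨z.1 - (ctr k).1, z.2 - (ctr k).2⟩ with hw
  have hn : ‖w‖ = rad k := by
    rw [Complex.norm_def, Complex.normSq_mk, ← Real.sqrt_sq hk.le]
    congr 1
    linarith
  have h1 := Complex.norm_mul_cos_arg w
  have h2 := Complex.norm_mul_sin_arg w
  rw [hn] at h1 h2
  refine ⟨w.arg, Prod.ext ?_ ?_⟩
  · change (ctr k).1 + rad k * Real.cos w.arg = z.1
    rw [h1, hw]
    ring
  · change (ctr k).2 + rad k * Real.sin w.arg = z.2
    rw [h2, hw]
    ring

lemma mem_Ddisc {z : ℝ × ℝ} : z ∈ Ddisc ctr rad k ↔ pev (fk ctr rad k) z ≤ 0 := by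
  rw [Ddisc, mem_ofPred_eq, pev_fk, sub_nonpos]

lemma sq_dist_add_sq_le {i j : Fin n} (h : Ccir ctr rad i ⊆ Ddisc ctr rad j) :
    ((ctr i).1 - (ctr j).1) ^ 2 + ((ctr i).2 - (ctr j).2) ^ 2 + rad i ^ 2 ≤ rad j ^ 2 := by
  have h1 := h (circlePt_mem 0)
  have h2 := h (circlePt_mem Real.pi)
  simp only [Ddisc, mem_ofPred_eq, circlePt, Real.cos_zero, Real.sin_zero, Real.cos_pi,
    Real.sin_pi] at h1 h2
  nlinarith

lemma Ddisc_subset {i j : Fin n} (h : Ccir ctr rad i ⊆ Ddisc ctr rad j) :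
    Ddisc ctr rad i ⊆ Ddisc ctr rad j := by
  intro z hz
  rw [Ddisc, mem_ofPred_eq] at hz
  set s := Real.sqrt (rad i ^ 2 - (z.2 - (ctr i).2) ^ 2) with hs
  have hs2 : s ^ 2 = rad i ^ 2 - (z.2 - (ctr i).2) ^ 2 :=
    Real.sq_sqrt (by nlinarith [sq_nonneg (z.1 - (ctr i).1)])
  have hs0 : 0 ≤ s := Real.sqrt_nonneg _
  have hzs := abs_le_of_sq_le_sq' (a := z.1 - (ctr i).1) (b := s) (by linarith) hs0
  have hmem : ∀ u, u ^ 2 = s ^ 2 → ((ctr i).1 + u, z.2) ∈ Ddisc ctr rad j := fun u hu =>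
    h (by rw [Ccir, mem_ofPred_eq, pev_fk]; linarith [hu, hs2, add_sub_cancel_left (ctr i).1 u,
      congrArg (· ^ 2) (add_sub_cancel_left (ctr i).1 u)])
  have h1 := hmem s rfl
  have h2 := hmem (-s) (neg_sq s)
  simp only [Ddisc, mem_ofPred_eq] at h1 h2 ⊢
  rcases le_total (ctr j).1 (ctr i).1 with hc | hc <;> nlinarith

/-- Every closed disc of the configuration contains the center of a primary circle. -/
lemma innerIdx_nonempty (hrad : ∀ k, 0 < rad k)
    (hdisj : ∀ j k, j ≠ k → Disjoint (Ccir ctr rad j) (Ccir ctr rad k))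
    (hctr : ∀ j k, ctr j ∉ Ccir ctr rad k)
    (hprim : ∀ k, Primary ctr rad k ↔ (k : ℕ) < r) : (innerIdx r ctr rad k).Nonempty := by
  obtain ⟨j, hj, hmin⟩ := (Finset.univ.filter fun j => Ddisc ctr rad j ⊆ Ddisc ctr rad k
    ).exists_min_image rad ⟨k, by simp⟩
  rw [Finset.mem_filter] at hj
  have hjp : Primary ctr rad j := by
    intro i hij hsub
    have h1 := sq_dist_add_sq_le hsub
    have h2 := hmin i (Finset.mem_filter.2 ⟨Finset.mem_univ i, (Ddisc_subset hsub).trans hj.2⟩)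
    have h3 : rad i = rad j := by
      refine le_antisymm (abs_le_of_sq_le_sq' ?_ (hrad j).le).2 h2
      nlinarith [sq_nonneg ((ctr i).1 - (ctr j).1), sq_nonneg ((ctr i).2 - (ctr j).2)]
    rw [h3] at h1
    have h4 : (ctr i).1 = (ctr j).1 := by
      nlinarith [sq_nonneg ((ctr i).1 - (ctr j).1), sq_nonneg ((ctr i).2 - (ctr j).2)]
    have h5 : (ctr i).2 = (ctr j).2 := by
      nlinarith [sq_nonneg ((ctr i).1 - (ctr j).1), sq_nonneg ((ctr i).2 - (ctr j).2)]
    refine disjoint_left.1 (hdisj i j hij) (circlePt_mem (k := i) 0) ?_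
    rw [h3, show ctr i = ctr j from Prod.ext h4 h5]
    exact circlePt_mem 0
  refine ⟨j, Finset.mem_filter.2 ⟨Finset.mem_filter.2 ⟨Finset.mem_univ j, (hprim j).1 hjp⟩, ?_⟩⟩
  have hc : ctr j ∈ Ddisc ctr rad j := by
    rw [mem_Ddisc, pev_fk]
    nlinarith [hrad j]
  exact lt_of_le_of_ne (mem_Ddisc.1 (hj.2 hc)) (hctr j k)

lemma pev_gpoly_pos (hctr : ∀ j k, ctr j ∉ Ccir ctr rad k) {z : ℝ × ℝ} (hz : z ∈ Ccir ctr rad k)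
    (i : Fin n) : 0 < pev (gpoly (ctr i)) z := by
  rw [pev_gpoly]
  refine lt_of_le_of_ne (by positivity) fun h => hctr i k ?_
  have h1 : z.1 = (ctr i).1 := by
    nlinarith [sq_nonneg (z.1 - (ctr i).1), sq_nonneg (z.2 - (ctr i).2)]
  have h2 : z.2 = (ctr i).2 := by
    nlinarith [sq_nonneg (z.1 - (ctr i).1), sq_nonneg (z.2 - (ctr i).2)]
  rwa [← show z = ctr i from Prod.ext h1 h2]

lemma pev_fk_ne_zero (hdisj : ∀ j k, j ≠ k → Disjoint (Ccir ctr rad j) (Ccir ctr rad k))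
    {z : ℝ × ℝ} (hz : z ∈ Ccir ctr rad k) {j : Fin n} (hj : j ≠ k) :
    pev (fk ctr rad j) z ≠ 0 :=
  fun h => disjoint_left.1 (hdisj j k hj) h hz

lemma Ccir_subset_regularRegion
    (hdisj : ∀ j k, j ≠ k → Disjoint (Ccir ctr rad j) (Ccir ctr rad k))
    (hctr : ∀ j k, ctr j ∉ Ccir ctr rad k) :
    Ccir ctr rad k ⊆ regularRegion r ctr rad k := by
  intro z hz
  refine ⟨fun i _ => (pev_gpoly_pos hctr hz i).ne',
    fun j hj => pev_fk_ne_zero hdisj hz (Finset.ne_of_mem_erase hj), fun i hi => ?_⟩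
  have h1 := pev_gpoly_pos hctr hz i
  have h2 := not_lt.1 (Finset.mem_filter.1 hi).2
  have hz' : pev (fk ctr rad k) z = 0 := hz
  rw [pev_gpoly] at h1
  rw [pev_fk] at h2 hz'
  simp only [dotAt, Prod.fst_sub, Prod.snd_sub]
  nlinarith

/-- The sign of `μ_k` on `C_k`. -/
lemma neg_one_pow_mul_muk_pos (hrad : ∀ k, 0 < rad k)
    (hdisj : ∀ j k, j ≠ k → Disjoint (Ccir ctr rad j) (Ccir ctr rad k))
    {z : ℝ × ℝ} (hz : z ∈ Ccir ctr rad k) :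
    0 < (-1 : ℝ) ^ Nk ctr rad k * pev (muk ctr rad k) z := by
  have hN : (-1 : ℝ) ^ Nk ctr rad k =
      ∏ j ∈ Finset.univ.erase k, if Ccir ctr rad k ⊆ Ddisc ctr rad j then (-1 : ℝ) else 1 := by
    rw [Finset.prod_ite, Finset.prod_const, Finset.prod_const_one, mul_one, Nk,
      Nat.card_eq_fintype_card, Fintype.card_subtype]
    congr 2
    ext j
    simp
  rw [hN, muk, pev_prod, ← Finset.prod_mul_distrib]
  refine Finset.prod_pos fun j hj => ?_
  have hne : ∀ w ∈ Ccir ctr rad k, pev (fk ctr rad j) w ≠ 0 := fun w hw =>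
    pev_fk_ne_zero hdisj hw (Finset.ne_of_mem_erase hj)
  split_ifs with h
  · linarith [lt_of_le_of_ne (mem_Ddisc.1 (h hz)) (hne z hz)]
  · obtain ⟨w, hw, hwj⟩ := not_subset.1 h
    rw [mem_Ddisc, not_le] at hwj
    rw [one_mul]
    by_contra! hzj
    have hpre : IsPreconnected (Ccir ctr rad k) :=
      range_circlePt (hrad k) ▸ isPreconnected_range (continuous_circlePt (ctr k) (rad k))
    obtain ⟨p, hp, hp0⟩ :=
      hpre.intermediate_value hz hw (continuous_pev (fk ctr rad j)).continuousOn ⟨hzj, hwj.le⟩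
    exact hne p hp hp0

lemma neg_one_pow_mul_speed_pos (hrad : ∀ k, 0 < rad k)
    (hdisj : ∀ j k, j ≠ k → Disjoint (Ccir ctr rad j) (Ccir ctr rad k))
    (hctr : ∀ j k, ctr j ∉ Ccir ctr rad k) {z : ℝ × ℝ} (hz : z ∈ Ccir ctr rad k) :
    0 < (-1 : ℝ) ^ Nk ctr rad k * pev (speed r ctr rad k) z := by
  rw [speed, pev_mul, mul_left_comm, Bpoly, pev_prod]
  exact mul_pos (Finset.prod_pos fun i _ => pev_gpoly_pos hctr hz i)
    (neg_one_pow_mul_muk_pos hrad hdisj hz)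

lemma pev_PT_of_mem {z : ℝ × ℝ} (hz : z ∈ Ccir ctr rad k) :
    pev (PT r ctr rad τ) z = -(2 * τ k * pev (speed r ctr rad k) z * (z.2 - (ctr k).2)) := by
  have hz' : pev (fk ctr rad k) z = 0 := hz
  rw [PT_eq r ctr rad τ k]
  simp only [pev_sub, pev_mul, pev_C, hz', pev_pderiv_one_fk]
  ring

lemma pev_QT_of_mem {z : ℝ × ℝ} (hz : z ∈ Ccir ctr rad k) :
    pev (QT r ctr rad τ) z = 2 * τ k * pev (speed r ctr rad k) z * (z.1 - (ctr k).1) := by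
  have hz' : pev (fk ctr rad k) z = 0 := hz
  rw [QT_eq r ctr rad τ k]
  simp only [pev_add, pev_mul, pev_C, hz', pev_pderiv_zero_fk]
  ring

/-- The sign of the swirl on `C_k`. -/
lemma neg_one_pow_mul_swirl_pos (hrad : ∀ k, 0 < rad k)
    (hdisj : ∀ j k, j ≠ k → Disjoint (Ccir ctr rad j) (Ccir ctr rad k))
    (hctr : ∀ j k, ctr j ∉ Ccir ctr rad k)
    (hprim : ∀ k, Primary ctr rad k ↔ (k : ℕ) < r) (hτ : ∀ k, 0 < τ k)
    {z : ℝ × ℝ} (hz : z ∈ Ccir ctr rad k) :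
    0 < (-1 : ℝ) ^ Nk ctr rad k * swirl r ctr rad τ k z := by
  rw [swirl, mul_left_comm, Finset.mul_sum]
  refine mul_pos two_pos (Finset.sum_pos (fun i hi => ?_)
    (innerIdx_nonempty hrad hdisj hctr hprim))
  have h1 := pev_gpoly_pos hctr hz i
  have h2 := (Finset.mem_filter.1 hi).2
  have hz' : pev (fk ctr rad k) z = 0 := hz
  have h3 := mul_pos (hτ k) (neg_one_pow_mul_speed_pos (r := r) hrad hdisj hctr hz)
  rw [angularRate, pev_PT_of_mem hz, pev_QT_of_mem hz, ← mul_div_assoc]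
  refine div_pos ?_ h1
  rw [pev_gpoly] at h1
  rw [pev_fk] at h2 hz'
  have h4 : 0 < 2 * ((z.1 - (ctr i).1) * (z.1 - (ctr k).1) +
      (z.2 - (ctr i).2) * (z.2 - (ctr k).2)) := by nlinarith
  linarith [mul_pos h3 h4]

end

lemma hasDerivAt_circlePt (c : ℝ × ℝ) (ρ : ℝ) {θ : ℝ → ℝ} {v t : ℝ} (h : HasDerivAt θ v t) :
    HasDerivAt (fun s => circlePt c ρ (θ s))
      (-(ρ * Real.sin (θ t) * v), ρ * Real.cos (θ t) * v) t :=
  (((h.cos.const_mul ρ).const_add c.1).prodMk ((h.sin.const_mul ρ).const_add c.2)).congr_deriv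
    (Prod.ext (by ring) (by ring))

lemma circlePt_add_two_pi (c : ℝ × ℝ) (ρ θ : ℝ) :
    circlePt c ρ (θ + 2 * Real.pi) = circlePt c ρ θ := by
  simp only [circlePt, Real.cos_add_two_pi, Real.sin_add_two_pi]

section

variable {r : ℕ} {ctr : Fin n → ℝ × ℝ} {rad τ : Fin n → ℝ} {k : Fin n}

/-- The angular equation of motion on `C_k` has a solution running through the whole circle
periodically. -/
lemma exists_angle_solution (hrad : ∀ k, 0 < rad k)
    (hdisj : ∀ j k, j ≠ k → Disjoint (Ccir ctr rad j) (Ccir ctr rad k))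
    (hctr : ∀ j k, ctr j ∉ Ccir ctr rad k) (hτ : ∀ k, 0 < τ k) :
    ∃ θ : ℝ → ℝ, ∃ T : ℝ, 0 < T ∧
      (∀ t, HasDerivAt θ
        (2 * τ k * pev (speed r ctr rad k) (circlePt (ctr k) (rad k) (θ t))) t) ∧
      Periodic (fun t => circlePt (ctr k) (rad k) (θ t)) T ∧ Surjective θ := by
  set v : ℝ → ℝ := fun θ => (-1 : ℝ) ^ Nk ctr rad k *
    (2 * τ k * pev (speed r ctr rad k) (circlePt (ctr k) (rad k) θ)) with hv
  have hc : Continuous v := continuous_const.mul (continuous_const.mul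
    ((continuous_pev _).comp (continuous_circlePt _ _)))
  have hpos : ∀ θ, 0 < v θ := fun θ => by
    have h1 := neg_one_pow_mul_speed_pos (r := r) hrad hdisj hctr (circlePt_mem (k := k) θ)
    have h2 := mul_pos (mul_pos two_pos (hτ k)) h1
    simp only [hv]
    linarith
  have hper : Periodic v (2 * Real.pi) := fun θ => by simp only [hv, circlePt_add_two_pi]
  obtain ⟨θ, T, hT, hθ, hadd, hsurj⟩ :=
    exists_hasDerivAt_of_periodic_pos Real.two_pi_pos hc hpos hper
  rcases neg_one_pow_eq_or ℝ (Nk ctr rad k) with h | h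
  · refine ⟨θ, T, hT, fun t => (hθ t).congr_deriv (by simp only [hv, h, one_mul]), fun t => ?_,
      hsurj⟩
    simp only [hadd, circlePt_add_two_pi]
  · refine ⟨fun t => θ (-t), T, hT, fun t => ?_, fun t => ?_, hsurj.comp neg_surjective⟩
    · refine ((hθ (-t)).comp t (hasDerivAt_neg t)).congr_deriv ?_
      simp only [hv, h]
      ring
    · have := hadd (-(t + T))
      rw [show -(t + T) + T = -t by ring] at this
      simp only [this, circlePt_add_two_pi]

lemma isPeriodicOrbit_Ccir (hrad : ∀ k, 0 < rad k)
    (hdisj : ∀ j k, j ≠ k → Disjoint (Ccir ctr rad j) (Ccir ctr rad k))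
    (hctr : ∀ j k, ctr j ∉ Ccir ctr rad k) (hτ : ∀ k, 0 < τ k) :
    IsPeriodicOrbit (PT r ctr rad τ) (QT r ctr rad τ) (Ccir ctr rad k) := by
  obtain ⟨θ, T, hT, hθ, hper, hsurj⟩ :=
    exists_angle_solution (r := r) (k := k) hrad hdisj hctr hτ
  refine ⟨fun t => circlePt (ctr k) (rad k) (θ t), T, hT, fun t => ?_, hper, ?_, ?_⟩
  · refine (hasDerivAt_circlePt (ctr k) (rad k) (hθ t)).congr_deriv ?_
    rw [pev_PT_of_mem (circlePt_mem (k := k) (θ t)), pev_QT_of_mem (circlePt_mem (k := k) (θ t))]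
    refine Prod.ext ?_ ?_ <;> simp only [circlePt] <;> ring
  · obtain ⟨t₀, h₀⟩ := hsurj 0
    obtain ⟨t₁, h₁⟩ := hsurj Real.pi
    refine ⟨t₀, t₁, fun h => ?_⟩
    have := congrArg Prod.fst h
    simp only [circlePt, h₀, h₁, Real.cos_zero, Real.cos_pi] at this
    linarith [hrad k]
  · rw [← range_circlePt (hrad k)]
    exact hsurj.range_comp (circlePt (ctr k) (rad k))

lemma isCompact_Ccir (hk : 0 < rad k) : IsCompact (Ccir ctr rad k) := by
  have hper : Periodic (circlePt (ctr k) (rad k)) (2 * Real.pi) := circlePt_add_two_pi _ _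
  exact range_circlePt hk ▸
    hper.compact_of_continuous Real.two_pi_pos.ne' (continuous_circlePt _ _)

lemma isBounded_abs_fk_le_one : Bornology.IsBounded {z | |pev (fk ctr rad k) z| ≤ 1} := by
  refine (Metric.isBounded_closedBall (x := ctr k) (r := rad k ^ 2 + 2)).subset fun z hz => ?_
  rw [mem_ofPred_eq, pev_fk] at hz
  have h := (abs_le.1 hz).2
  rw [Metric.mem_closedBall, Prod.dist_eq, Real.dist_eq, Real.dist_eq, max_le_iff]
  constructor
  · refine abs_le_of_sq_le_sq ?_ (by positivity)
    nlinarith [sq_nonneg (z.2 - (ctr k).2), sq_nonneg (rad k)]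
  · refine abs_le_of_sq_le_sq ?_ (by positivity)
    nlinarith [sq_nonneg (z.1 - (ctr k).1), sq_nonneg (rad k)]

/-- The sublevel sets of `|f_k|` form a basis of neighborhoods of `C_k`. -/
lemma exists_abs_fk_lt_subset {O : Set (ℝ × ℝ)} (hO : IsOpen O) (hsub : Ccir ctr rad k ⊆ O) :
    ∃ ε > 0, ∀ z, |pev (fk ctr rad k) z| < ε → z ∈ O := by
  have hf : Continuous fun z => |pev (fk ctr rad k) z| := (continuous_pev _).abs
  have hK : IsCompact ({z | |pev (fk ctr rad k) z| ≤ 1} \ O) :=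
    Metric.isCompact_of_isClosed_isBounded
      ((isClosed_le hf continuous_const).sdiff hO) (isBounded_abs_fk_le_one.subset sdiff_subset)
  rcases ({z | |pev (fk ctr rad k) z| ≤ 1} \ O).eq_empty_or_nonempty with h | h
  · exact ⟨1, one_pos, fun z hz => sdiff_eq_empty.1 h (le_of_lt hz)⟩
  · obtain ⟨p, hp, hmin⟩ := hK.exists_isMinOn h hf.continuousOn
    refine ⟨|pev (fk ctr rad k) p|, abs_pos.2 fun h0 => hp.2 (hsub h0), fun z hz => ?_⟩
    by_contra hzO
    exact hz.not_ge (hmin ⟨hz.le.trans hp.1, hzO⟩)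

lemma exists_isolating_neighborhood (hrad : ∀ k, 0 < rad k)
    (hdisj : ∀ j k, j ≠ k → Disjoint (Ccir ctr rad j) (Ccir ctr rad k))
    (hctr : ∀ j k, ctr j ∉ Ccir ctr rad k)
    (hprim : ∀ k, Primary ctr rad k ↔ (k : ℕ) < r) (hτ : ∀ k, 0 < τ k) :
    ∃ U : Set (ℝ × ℝ), IsOpen U ∧ Ccir ctr rad k ⊆ U ∧
      ∀ S', IsPeriodicOrbit (PT r ctr rad τ) (QT r ctr rad τ) S' → S' ≠ Ccir ctr rad k →
        Disjoint S' U := by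
  have hreg := Ccir_subset_regularRegion (r := r) (k := k) hdisj hctr
  obtain ⟨M, hM⟩ := (isCompact_Ccir (hrad k)).exists_bound_of_continuousOn
    ((continuousOn_lyap r ctr rad τ k).mono hreg)
  set σ : ℝ := (-1) ^ Nk ctr rad k with hσ
  have hO : IsOpen (regularRegion r ctr rad k ∩
      (fun z => (σ * swirl r ctr rad τ k z, |lyap r ctr rad τ k z|)) ⁻¹'
        (Ioi 0 ×ˢ Iio (|M| + 1))) :=
    ((continuousOn_const.mul (continuousOn_swirl r ctr rad τ k)).prodMk
      (continuousOn_lyap r ctr rad τ k).abs).isOpen_inter_preimage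
      (isOpen_regularRegion r ctr rad k) (isOpen_Ioi.prod isOpen_Iio)
  obtain ⟨ε, hε, hεO⟩ := exists_abs_fk_lt_subset hO fun z hz =>
    ⟨hreg hz, neg_one_pow_mul_swirl_pos hrad hdisj hctr hprim hτ hz,
      ((hM z hz).trans (le_abs_self M)).trans_lt (lt_add_one _)⟩
  have hf : Continuous fun z => |pev (fk ctr rad k) z| := (continuous_pev _).abs
  refine ⟨{z | |pev (fk ctr rad k) z| < ε * Real.exp (-(2 * (|M| + 1) / τ k))},
    isOpen_lt hf continuous_const, fun z hz => ?_, ?_⟩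
  · have hz' : pev (fk ctr rad k) z = 0 := hz
    rw [mem_ofPred_eq, hz', abs_zero]
    positivity
  rintro _ ⟨γ, T, hT, hγ, hper, -, rfl⟩ hne
  refine disjoint_left.2 ?_
  rintro _ ⟨t₀, rfl⟩ ht₀
  have hoff : ∀ t, pev (fk ctr rad k) (γ t) ≠ 0 := fun t ht => by
    obtain ⟨δ, S, hS, hδ, hperδ, -, hδr⟩ :=
      isPeriodicOrbit_Ccir (r := r) (k := k) hrad hdisj hctr hτ
    obtain ⟨s, hs⟩ : γ t ∈ range δ := hδr ▸ ht
    exact hne ((hγ.range_eq hδ hT hS hper hperδ hs.symm).trans hδr)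
  have hmain : ∀ e : ℝ, e = -σ → (e = 1 ∨ e = -1) → False := by
    intro e he he1
    have hpT : γ (t₀ + e * T) = γ t₀ := by
      rcases he1 with rfl | rfl
      · rw [one_mul, hper]
      · rw [neg_one_mul, ← sub_eq_add_neg, hper.sub_eq]
    have hc : Continuous fun s => γ (t₀ + e * s) := hγ.continuous.comp (by fun_prop)
    refine not_return_of_log_decreasing (u := fun s => |pev (fk ctr rad k) (γ (t₀ + e * s))|)
      (w := fun s => lyap r ctr rad τ k (γ (t₀ + e * s)))
      (d := fun s => e * swirl r ctr rad τ k (γ (t₀ + e * s))) hT hε (M := |M| + 1)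
      (by positivity) (hτ k) (hf.comp hc) (fun s => abs_pos.2 (hoff _))
      (fun s hs => (hεO _ hs).2.2.le) (fun s hs => ?_) (fun s hs => ?_) ?_ ?_ ?_
    · have h1 := hasDerivAt_log_fk_add_lyap (τ := τ) (hγ (t₀ + e * s)) (hεO _ hs).1 (hoff _)
      have h2 : HasDerivAt (fun s => t₀ + e * s) e s := by
        simpa using ((hasDerivAt_id s).const_mul e).const_add t₀
      exact (h1.comp s h2).congr_deriv (mul_comm _ _)
    · have : 0 < σ * swirl r ctr rad τ k (γ (t₀ + e * s)) := (hεO _ hs).2.1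
      simp only [he, neg_mul] at this ⊢
      exact neg_neg_of_pos this
    · simpa using ht₀
    · simp only [hpT, mul_zero, add_zero]
    · simp only [hpT, mul_zero, add_zero]
  refine hmain (-σ) rfl ?_
  rcases neg_one_pow_eq_or ℝ (Nk ctr rad k) with h | h <;> simp [hσ, h]

/-- The characteristic exponent of `C_k` is the integral of the swirl. -/
lemma mul_integral_divPoly (hrad : ∀ k, 0 < rad k)
    (hdisj : ∀ j k, j ≠ k → Disjoint (Ccir ctr rad j) (Ccir ctr rad k))
    (hctr : ∀ j k, ctr j ∉ Ccir ctr rad k) {γ : ℝ → ℝ × ℝ} {T : ℝ}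
    (hγ : IsSolution (PT r ctr rad τ) (QT r ctr rad τ) γ) (hper : Periodic γ T)
    (hmem : ∀ t, γ t ∈ Ccir ctr rad k) (hsw : Continuous fun t => swirl r ctr rad τ k (γ t)) :
    τ k * ∫ t in (0 : ℝ)..T, pev (divPoly (PT r ctr rad τ) (QT r ctr rad τ)) (γ t) =
      ∫ t in (0 : ℝ)..T, swirl r ctr rad τ k (γ t) := by
  have hdiv : Continuous fun t =>
      τ k * pev (divPoly (PT r ctr rad τ) (QT r ctr rad τ)) (γ t) :=
    continuous_const.mul ((continuous_pev _).comp hγ.continuous)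
  have hder : ∀ t, HasDerivAt
      (fun s => τ k * Real.log (pev (speed r ctr rad k) (γ s)) - lyap r ctr rad τ k (γ s))
      (τ k * pev (divPoly (PT r ctr rad τ) (QT r ctr rad τ)) (γ t) -
        swirl r ctr rad τ k (γ t)) t := fun t => by
    have hs : pev (speed r ctr rad k) (γ t) ≠ 0 := fun h => by
      simpa [h] using neg_one_pow_mul_speed_pos (r := r) hrad hdisj hctr (hmem t)
    refine (((hasDerivAt_log_pev _ (hγ t) hs).const_mul (τ k)).sub
      (hasDerivAt_lyap (hγ t) (Ccir_subset_regularRegion hdisj hctr (hmem t)))).congr_deriv ?_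
    have := speed_mul_divPoly r ctr rad τ k (hmem t)
    field_simp
    linear_combination -τ k * this
  have hFTC := intervalIntegral.integral_eq_sub_of_hasDerivAt (a := 0) (b := T)
    (fun t _ => hder t) ((hdiv.sub hsw).intervalIntegrable 0 T)
  rw [intervalIntegral.integral_sub (hdiv.intervalIntegrable 0 T) (hsw.intervalIntegrable 0 T),
    intervalIntegral.integral_const_mul, hper.eq, sub_self] at hFTC
  exact sub_eq_zero.1 hFTC

lemma neg_one_pow_mul_integral_divPoly_pos (hrad : ∀ k, 0 < rad k)
    (hdisj : ∀ j k, j ≠ k → Disjoint (Ccir ctr rad j) (Ccir ctr rad k))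
    (hctr : ∀ j k, ctr j ∉ Ccir ctr rad k)
    (hprim : ∀ k, Primary ctr rad k ↔ (k : ℕ) < r) (hτ : ∀ k, 0 < τ k)
    {γ : ℝ → ℝ × ℝ} {T : ℝ} (hT : 0 < T)
    (hγ : IsSolution (PT r ctr rad τ) (QT r ctr rad τ) γ) (hper : Periodic γ T)
    (hmem : ∀ t, γ t ∈ Ccir ctr rad k) :
    0 < (-1 : ℝ) ^ Nk ctr rad k *
      ∫ t in (0 : ℝ)..T, pev (divPoly (PT r ctr rad τ) (QT r ctr rad τ)) (γ t) := by
  have hsw : Continuous fun t => swirl r ctr rad τ k (γ t) :=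
    (continuousOn_swirl r ctr rad τ k).comp_continuous hγ.continuous fun t =>
      Ccir_subset_regularRegion hdisj hctr (hmem t)
  have h := intervalIntegral.intervalIntegral_pos_of_pos
    (f := fun t => (-1 : ℝ) ^ Nk ctr rad k * swirl r ctr rad τ k (γ t))
    ((continuous_const.mul hsw).intervalIntegrable 0 T)
    (fun t => neg_one_pow_mul_swirl_pos hrad hdisj hctr hprim hτ (hmem t)) hT
  rw [intervalIntegral.integral_const_mul,
    ← mul_integral_divPoly hrad hdisj hctr hγ hper hmem hsw, mul_left_comm] at h
  exact pos_of_mul_pos_right h (hτ k).le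

end

/-- Lemma 1 of the paper. Each circle `C_k` is a limit cycle of `X_T`, and
it is stable (negative characteristic exponent) if `N_k` is odd and unstable (positive
characteristic exponent) if `N_k` is even. -/
theorem limit_cycle_stability_XT
    (r : ℕ) (ctr : Fin n → ℝ × ℝ) (rad τ : Fin n → ℝ)
    (hn : 1 ≤ n) (hrn : r ≤ n) (hrad : ∀ k, 0 < rad k)
    (hdisj : ∀ j k, j ≠ k → Disjoint (Ccir ctr rad j) (Ccir ctr rad k))
    (hctr : ∀ j k, ctr j ∉ Ccir ctr rad k)
    (hprim : ∀ k, Primary ctr rad k ↔ (k : ℕ) < r)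
    (hτ : ∀ k, 0 < τ k) (k : Fin n) :
    IsLimitCycle (PT r ctr rad τ) (QT r ctr rad τ) (Ccir ctr rad k) ∧
    ∀ γ : ℝ → ℝ × ℝ, ∀ T : ℝ, 0 < T →
      IsSolution (PT r ctr rad τ) (QT r ctr rad τ) γ →
      Function.Periodic γ T → Set.range γ = Ccir ctr rad k →
      (Odd (Nk ctr rad k) →
        (∫ t in (0:ℝ)..T, pev (divPoly (PT r ctr rad τ) (QT r ctr rad τ)) (γ t)) < 0) ∧
      (Even (Nk ctr rad k) →
        0 < ∫ t in (0:ℝ)..T, pev (divPoly (PT r ctr rad τ) (QT r ctr rad τ)) (γ t)) := by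
  refine ⟨⟨isPeriodicOrbit_Ccir hrad hdisj hctr hτ,
    exists_isolating_neighborhood hrad hdisj hctr hprim hτ⟩, fun γ T hT hγ hper hrange => ?_⟩
  have h := neg_one_pow_mul_integral_divPoly_pos (k := k) hrad hdisj hctr hprim hτ hT hγ hper
    fun t => hrange ▸ mem_range_self t
  refine ⟨fun hodd => ?_, fun heven => ?_⟩
  · rw [hodd.neg_one_pow] at h
    linarith
  · rwa [heven.neg_one_pow, one_mul] at h
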